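/- Let Γ be a finite multigraph and m : Edges(Γ) → ℕ, and let Γ̃_m be the subdivision of Γ in which each edge e is subdivided into m(e)+1 edges. Then the complexity of Γ̃_m is given by c(Γ̃_m) = Σ_G ( ∏_{e ∈ Edges(Γ) ∖ Edges(G)} m(e) ) · c(G), where the sum runs over all connected spanning subgraphs G of Γ. -/

import Mathlib

open Finset

variable {V E : Type} [Fintype V] [Fintype E] [DecidableEq V] [DecidableEq E]

/-- The unordered pair of endpoints of an edge. -/
def eSym (ends : E → V × V) (e : E) : Sym2 V := s((ends e).1, (ends e).2)

/-- Reachability in the spanning subgraph with edge set `A`. -/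
def Linked (ends : E → V × V) (A : Finset E) : V → V → Prop :=
  Relation.ReflTransGen (fun v w => ∃ e ∈ A, eSym ends e = s(v, w))

/-- The spanning subgraph with edge set `A` is connected. -/
def Conn (ends : E → V × V) (A : Finset E) : Prop :=
  Nonempty V ∧ ∀ v w : V, Linked ends A v w

/-- The induced subgraph on the vertex set `W` is connected. -/
def ConnOn (ends : E → V × V) (W : Finset V) : Prop :=
  W.Nonempty ∧ ∀ v ∈ W, ∀ w ∈ W,
    Relation.ReflTransGen (fun a b => a ∈ W ∧ b ∈ W ∧ ∃ e : E, eSym ends e = s(a, b)) v w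

/-- A spanning tree: a connected spanning subgraph with `|V| - 1` edges. -/
def IsSpanningTree (ends : E → V × V) (A : Finset E) : Prop :=
  Conn ends A ∧ A.card + 1 = Fintype.card V

/-- The complexity of the spanning subgraph `A`: the number of its spanning trees. -/
noncomputable def complexity (ends : E → V × V) (A : Finset E) : ℕ :=
  Nat.card {T : Finset E // T ⊆ A ∧ IsSpanningTree ends T}

/-- `n(G)`: the number of edges of `Γ` missing from the spanning subgraph `G`. -/
def nG (A : Finset E) : ℕ := (Finset.univ \ A).card

/-- The space of multidegrees of total degree `d` at `A`. -/
def Sdeg (d : ℤ) (A : Finset E) : Set (V → ℤ) :=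
  {x | ∑ v, x v = d - (nG A : ℤ)}

/-- The twister at vertex `v` of the spanning subgraph with edge set `A`. -/
def twVec (ends : E → V × V) (A : Finset E) (v : V) : V → ℤ := fun w =>
  if w = v then
    -((A.filter (fun e => v ∈ eSym ends e ∧ ¬(eSym ends e).IsDiag)).card : ℤ)
  else ((A.filter (fun e => eSym ends e = s(v, w))).card : ℤ)

/-- The twister (chip-firing) group of the spanning subgraph with edge set `A`. -/
def twGroup (ends : E → V × V) (A : Finset E) : AddSubgroup (V → ℤ) :=
  AddSubgroup.closure (Set.range (twVec ends A))

/-- The standard basis vector at `v`. -/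
def stdVec (v : V) : V → ℤ := fun w => if w = v then 1 else 0

/-- A degree-`d` assignment: supported on connected spanning subgraphs, with the
prescribed total degree. -/
def IsAssignment (ends : E → V × V) (d : ℤ) (σ : Finset E → Set (V → ℤ)) : Prop :=
  ∀ A : Finset E, ∀ x ∈ σ A, Conn ends A ∧ x ∈ Sdeg d A

/-- Condition (1), chip-adding. -/
def ChipAdding (ends : E → V × V) (σ : Finset E → Set (V → ℤ)) : Prop :=
  ∀ A : Finset E, ∀ x ∈ σ A, ∀ e ∉ A, ∀ v ∈ eSym ends e, x + stdVec v ∈ σ (insert e A)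

/-- `S` is a minimal complete set of representatives for the action of the twister group
of `A` on the multidegree space `S^d(A)`. -/
def IsRepSet (ends : E → V × V) (d : ℤ) (A : Finset E) (S : Set (V → ℤ)) : Prop :=
  S ⊆ Sdeg d A ∧ ∀ x ∈ Sdeg (E := E) d A, ∃! y, y ∈ S ∧ x - y ∈ twGroup ends A

/-- A degree-`d` stability assignment. -/
def IsStabilityAssignment (ends : E → V × V) (d : ℤ) (σ : Finset E → Set (V → ℤ)) : Prop :=
  IsAssignment ends d σ ∧ ChipAdding ends σ ∧
    ∀ A : Finset E, Conn ends A → IsRepSet ends d A (σ A)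

/-- Vertices of the subdivision `Γ̃_m`: original vertices plus, for each edge `e`,
`m e` exceptional vertices. -/
abbrev SubV (V E : Type) (m : E → ℕ) : Type := V ⊕ (Σ e : E, Fin (m e))

/-- Edges of the subdivision `Γ̃_m`: each edge `e` is replaced by a chain of `m e + 1` edges. -/
abbrev SubE (E : Type) (m : E → ℕ) : Type := Σ e : E, Fin (m e + 1)

/-- The `i`-th vertex along the chain replacing the edge `e` in the subdivision. -/
def subNode (ends : E → V × V) (m : E → ℕ) (e : E) (i : ℕ) : SubV V E m :=
  if h0 : i = 0 then Sum.inl (ends e).1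
  else if h : i ≤ m e then Sum.inr ⟨e, ⟨i - 1, by omega⟩⟩
  else Sum.inl (ends e).2

/-- The endpoints of the edges of the subdivision `Γ̃_m`. -/
def subEnds (ends : E → V × V) (m : E → ℕ) : SubE E m → SubV V E m × SubV V E m :=
  fun p => (subNode ends m p.1 p.2.val, subNode ends m p.1 (p.2.val + 1))

/-- The lift of the multidegree `x` on `(A, Γ)`: extend by zero and add one chip on
the exceptional vertex `t e` of every removed edge `e ∉ A`. -/
def liftOf (m : E → ℕ) (A : Finset E) (x : V → ℤ) (t : E → ℕ) : SubV V E m → ℤ :=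
  Sum.elim x fun p => if p.1 ∉ A ∧ (p.2 : ℕ) = t p.1 then 1 else 0

/-- The lift `σ̃_m` of an assignment `σ`: all lifts of all elements of `σ`. -/
def liftSet (m : E → ℕ) (σ : Finset E → Set (V → ℤ)) : Set (SubV V E m → ℤ) :=
  {y | ∃ (A : Finset E) (x : V → ℤ) (t : E → ℕ),
    x ∈ σ A ∧ (∀ e ∉ A, t e < m e) ∧ y = liftOf m A x t}

/-- Edges with both endpoints in `W` (the edges of the induced subgraph `Γ(W)`). -/
def inE (ends : E → V × V) (W : Finset V) : Finset E :=
  Finset.univ.filter fun e => (ends e).1 ∈ W ∧ (ends e).2 ∈ W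

/-- Edges with one endpoint in `W` and the other in `Wᶜ`. -/
def cutE (ends : E → V × V) (W : Finset V) : Finset E :=
  Finset.univ.filter fun e =>
    ((ends e).1 ∈ W ∧ (ends e).2 ∉ W) ∨ ((ends e).1 ∉ W ∧ (ends e).2 ∈ W)

/-- `φ`-semistability of the multidegree `x` on the spanning subgraph `A`. -/
def PhiSemistable (ends : E → V × V) (φ : V → ℝ) (A : Finset E) (x : V → ℤ) : Prop :=
  ∀ W : Finset V, W.Nonempty → W ≠ Finset.univ →
    |(∑ v ∈ W, ((x v : ℝ) - φ v)) + (((Finset.univ \ A) ∩ inE ends W).card : ℝ) +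
        (((Finset.univ \ A) ∩ cutE ends W).card : ℝ) / 2| ≤
      ((A ∩ cutE ends W).card : ℝ) / 2

/-- `φ`-stability of the multidegree `x` on the spanning subgraph `A`. -/
def PhiStable (ends : E → V × V) (φ : V → ℝ) (A : Finset E) (x : V → ℤ) : Prop :=
  ∀ W : Finset V, W.Nonempty → W ≠ Finset.univ →
    |(∑ v ∈ W, ((x v : ℝ) - φ v)) + (((Finset.univ \ A) ∩ inE ends W).card : ℝ) +
        (((Finset.univ \ A) ∩ cutE ends W).card : ℝ) / 2| <
      ((A ∩ cutE ends W).card : ℝ) / 2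

/-- Nondegeneracy of a numerical polarization `φ`. -/
def Nondegenerate (ends : E → V × V) (d : ℤ) (φ : V → ℝ) : Prop :=
  ∀ A : Finset E, ∀ x ∈ Sdeg d A, PhiSemistable ends φ A x → PhiStable ends φ A x

/-- The assignment `stab_{Γ,φ}` associated with a numerical polarization `φ`. -/
def stabAssign (ends : E → V × V) (d : ℤ) (φ : V → ℝ) : Finset E → Set (V → ℤ) :=
  fun A => {x | Conn ends A ∧ x ∈ Sdeg d A ∧ PhiSemistable ends φ A x}

/-- The valence of the vertex `v` (loops counted twice). -/
def valence (ends : E → V × V) (v : V) : ℕ :=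
  ∑ e : E, ((if (ends e).1 = v then 1 else 0) + (if (ends e).2 = v then 1 else 0))

/-- `x` is an integral break divisor for the connected spanning subgraph `A`. -/
def isIBD (ends : E → V × V) (gen : V → ℕ) (A : Finset E) (x : V → ℤ) : Prop :=
  ∃ T : Finset E, T ⊆ A ∧ IsSpanningTree ends T ∧
    ∃ t : E → V, (∀ e ∈ A \ T, t e ∈ eSym ends e) ∧
      x = fun v => (gen v : ℤ) + (((A \ T).filter fun e => t e = v).card : ℤ)

/-- The multidegree `(a, b)` on a two-vertex graph with first vertex `v₁`. -/
def pairFn (v₁ : V) (a b : ℤ) : V → ℤ := fun w => if w = v₁ then a else b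

section SubdivisionTrees

variable {ends : E → V × V} {m : E → ℕ}

omit [Fintype V] [Fintype E] [DecidableEq V] [DecidableEq E] in
theorem Linked.symm {A : Finset E} {v w : V} (h : Linked ends A v w) : Linked ends A w v := by
  have : Std.Symm fun a b => ∃ e ∈ A, eSym ends e = s(a, b) :=
    ⟨fun a b ⟨e, he, hab⟩ => ⟨e, he, hab.trans Sym2.eq_swap⟩⟩
  exact Relation.ReflTransGen.stdSymm.symm _ _ h

omit [Fintype V] [Fintype E] [DecidableEq V] [DecidableEq E] in
/-- A map of vertices that sends every edge of `A` to a linked pair preserves linkedness. -/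
theorem Linked.map {V' E' : Type} {ends' : E' → V' × V'} {A : Finset E} {B : Finset E'}
    (π : V → V') (hπ : ∀ e ∈ A, Linked ends' B (π (ends e).1) (π (ends e).2)) {v w : V}
    (h : Linked ends A v w) : Linked ends' B (π v) (π w) := by
  induction h with
  | refl => exact .refl
  | tail _ hbc ih =>
    obtain ⟨e, he, hab⟩ := hbc
    rw [eSym, Sym2.eq_iff] at hab
    obtain ⟨rfl, rfl⟩ | ⟨rfl, rfl⟩ := hab
    · exact Relation.ReflTransGen.trans ih (hπ e he)
    · exact Relation.ReflTransGen.trans ih (hπ e he).symm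

omit [Fintype V] [Fintype E] [DecidableEq V] [DecidableEq E] in
theorem Linked.of_edge {A : Finset E} {e : E} (he : e ∈ A) :
    Linked ends A (ends e).1 (ends e).2 :=
  .single ⟨e, he, rfl⟩

omit [Fintype V] [Fintype E] [DecidableEq V] [DecidableEq E] in
/-- A vertex set such that no edge of `A` leaves it is closed under linkedness. -/
theorem Linked.mem_of_closed {A : Finset E} (U : V → Prop)
    (hU : ∀ e ∈ A, (U (ends e).1 ↔ U (ends e).2)) {v w : V} (h : Linked ends A v w)
    (hv : U v) : U w := by
  induction h with
  | refl => exact hv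
  | tail _ hbc ih =>
    obtain ⟨e, he, hab⟩ := hbc
    have := hU e he
    rw [eSym, Sym2.eq_iff] at hab
    obtain ⟨rfl, rfl⟩ | ⟨rfl, rfl⟩ := hab <;> tauto

omit [Fintype V] [Fintype E] [DecidableEq V] [DecidableEq E] in
theorem subNode_zero (e : E) : subNode ends m e 0 = .inl (ends e).1 := by
  simp [subNode]

omit [Fintype V] [Fintype E] [DecidableEq V] [DecidableEq E] in
theorem subNode_last (e : E) : subNode ends m e (m e + 1) = .inl (ends e).2 := by
  simp [subNode]

omit [Fintype V] [Fintype E] [DecidableEq V] [DecidableEq E] in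
theorem subNode_succ (e : E) (k : Fin (m e)) : subNode ends m e (k + 1) = .inr ⟨e, k⟩ := by
  have := k.isLt
  simp [subNode]

/-- The edges of the original graph whose chain lies entirely in `S`. -/
def fullEdges (S : Finset (SubE E m)) : Finset E :=
  Finset.univ.filter fun e => ∀ i, (⟨e, i⟩ : SubE E m) ∈ S

/-- At most one edge of each chain is missing from `S`. -/
def MissesAtMostOne (S : Finset (SubE E m)) : Prop :=
  ∀ e, ∀ i j : Fin (m e + 1), (⟨e, i⟩ : SubE E m) ∉ S → (⟨e, j⟩ : SubE E m) ∉ S → i = j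

/-- The exceptional vertices of the chain of `e` strictly between the edges `i` and `j`. -/
def Between (e : E) (i j : ℕ) : SubV V E m → Prop :=
  Sum.elim (fun _ => False) fun p => p.1 = e ∧ i ≤ p.2.val ∧ p.2.val < j

omit [Fintype V] [Fintype E] [DecidableEq V] [DecidableEq E] in
theorem between_subNode {e : E} {i j : ℕ} (hj : j ≤ m e) (e' : E) {n : ℕ} :
    Between (V := V) (m := m) e i j (subNode ends m e' n) ↔ e' = e ∧ i < n ∧ n ≤ j := by
  unfold subNode
  split_ifs with h0 h
  · simp [Between, h0]
  · simp only [Between, Sum.elim_inr]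
    constructor <;> rintro ⟨rfl, _, _⟩ <;> refine ⟨rfl, ?_, ?_⟩ <;> omega
  · simp only [Between, Sum.elim_inl, false_iff]
    rintro ⟨rfl, _, _⟩
    omega

omit [Fintype V] [Fintype E] [DecidableEq V] [DecidableEq E] in
theorem Conn.missesAtMostOne {S : Finset (SubE E m)} (h : Conn (subEnds ends m) S) :
    MissesAtMostOne S := by
  suffices key : ∀ e, ∀ i j : Fin (m e + 1), (⟨e, i⟩ : SubE E m) ∉ S →
      (⟨e, j⟩ : SubE E m) ∉ S → ¬ i < j from
    fun e i j hi hj => le_antisymm (not_lt.1 (key e j i hj hi)) (not_lt.1 (key e i j hi hj))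
  intro e i j hi hj hij
  have hjm : (j : ℕ) ≤ m e := Nat.lt_succ_iff.1 j.isLt
  have hij' : (i : ℕ) < j := hij
  have hlink := h.2 (subNode ends m e (i + 1)) (subNode ends m e 0)
  have := hlink.mem_of_closed (Between e i j) ?_
    ((between_subNode hjm e).2 ⟨rfl, by omega, by omega⟩)
  · simp [between_subNode hjm] at this
  · rintro ⟨e', k⟩ hk
    simp only [subEnds, between_subNode hjm]
    refine and_congr_right ?_
    rintro rfl
    have hki : (k : ℕ) ≠ i := fun hki => hi (Fin.ext hki ▸ hk)
    have hkj : (k : ℕ) ≠ j := fun hkj => hj (Fin.ext hkj ▸ hk)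
    omega

open Classical in
/-- Contract each chain onto the original graph, pushing an exceptional vertex to the second
endpoint exactly when an earlier edge of its chain is missing from `S`. -/
noncomputable def contract (ends : E → V × V) (S : Finset (SubE E m)) : SubV V E m → V :=
  Sum.elim id fun p =>
    if ∃ i : Fin (m p.1 + 1), i.val ≤ p.2.val ∧ (⟨p.1, i⟩ : SubE E m) ∉ S
    then (ends p.1).2 else (ends p.1).1

omit [Fintype V] [Fintype E] [DecidableEq V] in
open Classical in
theorem contract_subNode (S : Finset (SubE E m)) (e : E) {n : ℕ} (hn : n ≤ m e) :
    contract ends S (subNode ends m e n) =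
      if ∃ i : Fin (m e + 1), i.val < n ∧ (⟨e, i⟩ : SubE E m) ∉ S
      then (ends e).2 else (ends e).1 := by
  obtain _ | k := n
  · simp [subNode_zero, contract]
  · have := subNode_succ (ends := ends) e ⟨k, hn⟩
    simp only at this
    simp [this, contract]

omit [Fintype V] [DecidableEq V] in
theorem linked_contract (S : Finset (SubE E m)) {x y : SubV V E m}
    (h : Linked (subEnds ends m) S x y) :
    Linked ends (fullEdges S) (contract ends S x) (contract ends S y) := by
  classical
  refine h.map _ ?_
  rintro ⟨e, k⟩ hk
  have hkm : (k : ℕ) ≤ m e := Nat.lt_succ_iff.1 k.isLt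
  have hiff : (∃ i : Fin (m e + 1), i.val < k.val + 1 ∧ (⟨e, i⟩ : SubE E m) ∉ S) ↔
      ∃ i : Fin (m e + 1), i.val < k.val ∧ (⟨e, i⟩ : SubE E m) ∉ S := by
    refine exists_congr fun i => and_congr_left fun hi => ?_
    have : (i : ℕ) ≠ k := fun hik => hi (Fin.ext hik ▸ hk)
    omega
  simp only [subEnds]
  rw [contract_subNode S e hkm]
  obtain hlt | heq := hkm.lt_or_eq
  · rw [contract_subNode S e hlt]
    simp only [hiff]
    exact .refl
  · rw [show (k : ℕ) + 1 = m e + 1 by omega, subNode_last, contract, Sum.elim_inl, id]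
    split_ifs with hex
    · exact .refl
    · refine .of_edge ?_
      simp only [fullEdges, Finset.mem_filter, Finset.mem_univ, true_and]
      intro i
      by_contra hi
      exact hex (hiff.1 ⟨i, by have := i.isLt; omega, hi⟩)

omit [Fintype V] [Fintype E] [DecidableEq V] [DecidableEq E] in
/-- The nodes `a` and `b` of a chain are linked if all edges between them are in `S`. -/
theorem linked_subNode {S : Finset (SubE E m)} {e : E} {a b : ℕ} (hab : a ≤ b)
    (hb : b ≤ m e + 1)
    (h : ∀ i : Fin (m e + 1), a ≤ i.val → i.val < b → (⟨e, i⟩ : SubE E m) ∈ S) :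
    Linked (subEnds ends m) S (subNode ends m e a) (subNode ends m e b) := by
  induction b, hab using Nat.le_induction with
  | base => exact .refl
  | succ b hab ih =>
    have hmem := h ⟨b, hb⟩ hab (Nat.lt_succ_self b)
    exact (ih (by omega) fun i h1 h2 => h i h1 (by omega)).trans (Linked.of_edge hmem)

omit [Fintype V] [DecidableEq V] in
theorem conn_subEnds_iff {S : Finset (SubE E m)} :
    Conn (subEnds ends m) S ↔ Conn ends (fullEdges S) ∧ MissesAtMostOne S := by
  constructor
  · refine fun h => ⟨⟨?_, fun v w => ?_⟩, h.missesAtMostOne⟩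
    · exact h.1.map (contract ends S)
    · exact linked_contract S (h.2 (.inl v) (.inl w))
  · rintro ⟨⟨⟨v₀⟩, hT⟩, hS⟩
    have hinl : ∀ v w : V, Linked (subEnds ends m) S (.inl v) (.inl w) := fun v w => by
      refine (hT v w).map Sum.inl fun e he => ?_
      have he' : ∀ i, (⟨e, i⟩ : SubE E m) ∈ S := by simpa [fullEdges] using he
      have := linked_subNode (ends := ends) (S := S) (Nat.zero_le _) le_rfl fun i _ _ => he' i
      rwa [subNode_zero, subNode_last] at this
    have hbase : ∀ x : SubV V E m, Linked (subEnds ends m) S x (.inl v₀) := by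
      rintro (v | ⟨e, k⟩)
      · exact hinl v v₀
      · have hk := k.isLt
        by_cases hlow : ∀ i : Fin (m e + 1), i.val < k.val + 1 → (⟨e, i⟩ : SubE E m) ∈ S
        · have := linked_subNode (ends := ends) (S := S) (Nat.zero_le (k.val + 1)) (by omega)
            fun i _ h => hlow i h
          rw [subNode_zero, subNode_succ] at this
          exact this.symm.trans (hinl _ _)
        · push Not at hlow
          obtain ⟨i, hik, hi⟩ := hlow
          have := linked_subNode (ends := ends) (S := S) (a := k.val + 1) (b := m e + 1)
            (by omega) le_rfl fun j hj _ => by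
              by_contra hjS
              have := hS e i j hi hjS
              omega
          rw [subNode_last, subNode_succ] at this
          exact this.trans (hinl _ _)
    exact ⟨⟨.inl v₀⟩, fun x y => (hbase x).trans (hbase y).symm⟩

/-- Delete the edge `i` from the chain of `e` whenever `f e = some i`. -/
def keepEdges (f : ∀ e, Option (Fin (m e + 1))) : Finset (SubE E m) :=
  Finset.univ.filter fun p => f p.1 ≠ some p.2

omit [DecidableEq E] in
theorem mem_keepEdges {f : ∀ e, Option (Fin (m e + 1))} {e : E} {i : Fin (m e + 1)} :
    (⟨e, i⟩ : SubE E m) ∈ keepEdges f ↔ f e ≠ some i := by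
  simp [keepEdges]

omit [DecidableEq E] in
theorem keepEdges_injective : Function.Injective (keepEdges (m := m)) := by
  intro f g h
  funext e
  refine Option.ext fun i => ?_
  have : (⟨e, i⟩ : SubE E m) ∈ keepEdges f ↔ (⟨e, i⟩ : SubE E m) ∈ keepEdges g := by rw [h]
  rw [mem_keepEdges, mem_keepEdges] at this
  exact not_iff_not.1 this

theorem fullEdges_keepEdges (f : ∀ e, Option (Fin (m e + 1))) :
    fullEdges (keepEdges f) = Finset.univ.filter fun e => f e = none := by
  ext e
  simp only [fullEdges, mem_keepEdges, Finset.mem_filter, Finset.mem_univ, true_and]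
  exact Option.eq_none_iff_forall_ne_some.symm

theorem missesAtMostOne_iff {S : Finset (SubE E m)} :
    MissesAtMostOne S ↔ ∃ f, keepEdges f = S := by
  classical
  constructor
  · intro h
    refine ⟨fun e => if hi : ∃ i, (⟨e, i⟩ : SubE E m) ∉ S then some hi.choose else none, ?_⟩
    ext ⟨e, i⟩
    rw [mem_keepEdges]
    split_ifs with hi
    · constructor
      · intro hne
        by_contra hmem
        exact hne (congrArg some (h e _ _ hi.choose_spec hmem))
      · intro hmem heq
        exact hi.choose_spec (Option.some.inj heq ▸ hmem)
    · push Not at hi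
      simp [hi i]
  · rintro ⟨f, rfl⟩ e i j hi hj
    rw [mem_keepEdges, not_not] at hi hj
    exact Option.some.inj (hi.symm.trans hj)

theorem card_keepEdges (f : ∀ e, Option (Fin (m e + 1))) :
    (keepEdges f).card = (∑ e, m e) + (fullEdges (keepEdges f)).card := by
  have hS : keepEdges f = Finset.univ.sigma fun e => Finset.univ.filter fun i => f e ≠ some i := by
    ext ⟨e, i⟩
    simp [mem_keepEdges]
  rw [fullEdges_keepEdges, Finset.card_filter, ← Finset.sum_add_distrib, hS, Finset.card_sigma]
  refine Finset.sum_congr rfl fun e _ => ?_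
  cases f e with
  | none => simp
  | some a => simp [Finset.filter_ne]

omit [DecidableEq V] in
theorem isSpanningTree_keepEdges_iff (f : ∀ e, Option (Fin (m e + 1))) :
    IsSpanningTree (subEnds ends m) (keepEdges f) ↔
      IsSpanningTree ends (Finset.univ.filter fun e => f e = none) := by
  have hmiss : MissesAtMostOne (keepEdges f) := missesAtMostOne_iff.2 ⟨f, rfl⟩
  have hcard : Fintype.card (SubV V E m) = Fintype.card V + ∑ e, m e := by simp
  rw [IsSpanningTree, IsSpanningTree, conn_subEnds_iff, card_keepEdges, hcard,
    fullEdges_keepEdges]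
  simp only [hmiss, and_true]
  refine and_congr_right fun _ => ?_
  omega

omit [DecidableEq V] in
open Classical in
theorem complexity_eq_card_filter (A : Finset E) :
    complexity ends A = ((Finset.univ.filter (IsSpanningTree ends)).filter (· ⊆ A)).card := by
  rw [complexity, Nat.card_eq_fintype_card, Fintype.card_subtype, Finset.filter_filter]
  simp only [and_comm]

theorem card_filter_none (T : Finset E) :
    ((Finset.univ : Finset (∀ e, Option (Fin (m e + 1)))).filter
      fun f => (Finset.univ.filter fun e => f e = none) = T).card =
      ∏ e ∈ Finset.univ \ T, (m e + 1) := by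
  have h : ((Finset.univ : Finset (∀ e, Option (Fin (m e + 1)))).filter
      fun f => (Finset.univ.filter fun e => f e = none) = T) =
      Fintype.piFinset fun e => if e ∈ T then {none} else Finset.univ.map .some := by
    ext f
    simp only [Finset.mem_filter, Finset.mem_univ, true_and, Fintype.mem_piFinset,
      Finset.ext_iff]
    refine forall_congr' fun e => ?_
    split_ifs with he
    · simp [he]
    · cases f e <;> simp [he]
  rw [h, Fintype.card_piFinset, ← Finset.compl_eq_univ_sdiff,
    ← Finset.prod_subset (Finset.subset_univ Tᶜ)]
  · refine Finset.prod_congr rfl fun e he => ?_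
    simp [Finset.mem_compl.1 he]
  · intro e _ he
    simp [not_not.1 (mt Finset.mem_compl.2 he)]

omit [DecidableEq V] in
open Classical in
theorem complexity_subEnds :
    complexity (subEnds ends m) Finset.univ =
      ∑ T ∈ Finset.univ.filter (IsSpanningTree ends), ∏ e ∈ Finset.univ \ T, (m e + 1) := by
  have himage : (Finset.univ.filter (IsSpanningTree (subEnds ends m))) =
      (Finset.univ.filter fun f : ∀ e, Option (Fin (m e + 1)) =>
        IsSpanningTree ends (Finset.univ.filter fun e => f e = none)).image keepEdges := by
    ext S
    simp only [Finset.mem_filter, Finset.mem_univ, true_and, Finset.mem_image]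
    constructor
    · intro hS
      obtain ⟨f, rfl⟩ := missesAtMostOne_iff.1 hS.1.missesAtMostOne
      exact ⟨f, (isSpanningTree_keepEdges_iff f).1 hS, rfl⟩
    · rintro ⟨f, hf, rfl⟩
      exact (isSpanningTree_keepEdges_iff f).2 hf
  rw [complexity_eq_card_filter, Finset.filter_true_of_mem fun S _ => Finset.subset_univ S,
    himage, Finset.card_image_of_injective _ keepEdges_injective,
    Finset.card_eq_sum_card_fiberwise
      (f := fun f : ∀ e, Option (Fin (m e + 1)) => Finset.univ.filter fun e => f e = none)
      (t := Finset.univ.filter (IsSpanningTree ends)) (fun f hf => by simpa using hf)]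
  refine Finset.sum_congr rfl fun T hT => ?_
  rw [← card_filter_none, Finset.filter_filter]
  congr 1
  refine Finset.filter_congr fun f _ => and_iff_right_of_imp ?_
  rintro rfl
  exact (Finset.mem_filter.1 hT).2

theorem sum_prod_sdiff_of_subset (T : Finset E) :
    ∑ G ∈ Finset.univ.filter (T ⊆ ·), ∏ e ∈ Finset.univ \ G, m e =
      ∏ e ∈ Finset.univ \ T, (m e + 1) := by
  rw [Finset.prod_add_one]
  refine Finset.sum_nbij' (Finset.univ \ ·) (Finset.univ \ ·) ?_ ?_ ?_ ?_ ?_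
  · intro G hG
    simpa [← Finset.compl_eq_univ_sdiff] using hG
  · intro G hG
    simpa [← Finset.compl_eq_univ_sdiff, Finset.subset_compl_comm] using hG
  all_goals simp

end SubdivisionTrees

/-- The complexity of the subdivision `Γ̃_m` equals
`Σ_G (∏_{e ∉ G} m e) · c(G)`, the sum over all (connected) spanning subgraphs `G` of `Γ`.
(The summand vanishes for disconnected `G` since then `c(G) = 0`.) -/
theorem statement5 (ends : E → V × V) (m : E → ℕ) :
    complexity (subEnds ends m) (Finset.univ : Finset (SubE E m)) =
      ∑ G : Finset E, (∏ e ∈ Finset.univ \ G, m e) * complexity ends G := by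
  classical
  simp_rw [complexity_subEnds, ← sum_prod_sdiff_of_subset, complexity_eq_card_filter,
    Finset.card_eq_sum_ones, Finset.mul_sum, mul_one]
  refine Finset.sum_comm' fun T G => ?_
  simp
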